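/- For k ≥ 6 and n ≥ 2, GM_k(K_3 : nK_2) ≤ (2n − 1)!!. -/

import Mathlib

open SimpleGraph Function

namespace GR

/-- The set of copies of a graph `H` (assumed without isolated vertices, so a copy is
identified with its edge set) inside the complete graph on `Fin n`. -/
def copies {α : Type} (H : SimpleGraph α) (n : ℕ) : Set (Set (Sym2 (Fin n))) :=
  {S | ∃ f : α → Fin n, Function.Injective f ∧ S = (Sym2.map f) '' H.edgeSet}

/-- `S` is a monochromatic copy of `H` under the edge-coloring `c`. -/
def IsMonoCopy {α C : Type} (H : SimpleGraph α) {n : ℕ}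
    (c : Sym2 (Fin n) → C) (S : Set (Sym2 (Fin n))) : Prop :=
  S ∈ copies H n ∧ ∃ col, ∀ e ∈ S, c e = col

/-- `S` is a rainbow copy of `G` under the edge-coloring `c`. -/
def IsRainbowCopy {α C : Type} (G : SimpleGraph α) {n : ℕ}
    (c : Sym2 (Fin n) → C) (S : Set (Sym2 (Fin n))) : Prop :=
  S ∈ copies G n ∧ Set.InjOn c S

def HasMonoCopy {α C : Type} (H : SimpleGraph α) {n : ℕ} (c : Sym2 (Fin n) → C) : Prop :=
  ∃ S, IsMonoCopy H c S

def HasRainbowCopy {α C : Type} (G : SimpleGraph α) {n : ℕ} (c : Sym2 (Fin n) → C) : Prop :=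
  ∃ S, IsRainbowCopy G c S

/-- The `k`-colored Gallai-Ramsey number `gr_k(G : H)`. -/
noncomputable def gr {α β : Type} (k : ℕ) (G : SimpleGraph α) (H : SimpleGraph β) : ℕ :=
  sInf {n | ∀ c : Sym2 (Fin n) → Fin k, HasRainbowCopy G c ∨ HasMonoCopy H c}

/-- The diagonal `k`-colored Ramsey number `r_k(H)`. -/
noncomputable def ramsey {β : Type} (k : ℕ) (H : SimpleGraph β) : ℕ :=
  sInf {n | ∀ c : Sym2 (Fin n) → Fin k, HasMonoCopy H c}

/-- The matching with `n` edges, `nK₂`. -/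
def nK2 (n : ℕ) : SimpleGraph (Fin n × Fin 2) :=
  SimpleGraph.fromRel (fun a b => a.1 = b.1)

/-- The path on 5 vertices. -/
def P5 : SimpleGraph (Fin 5) := SimpleGraph.pathGraph 5

/-- The star with three leaves. -/
def K13 : SimpleGraph (Fin 1 ⊕ Fin 3) := completeBipartiteGraph (Fin 1) (Fin 3)

/-- The triangle. -/
def K3 : SimpleGraph (Fin 3) := completeGraph (Fin 3)

/-- Number of monochromatic copies of `H` under the coloring `c`. -/
noncomputable def monoCopyCount {α C : Type} (H : SimpleGraph α) {n : ℕ}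
    (c : Sym2 (Fin n) → C) : ℕ :=
  Set.ncard {S | IsMonoCopy H c S}

/-- Number of rainbow copies of `G` under the coloring `c`. -/
noncomputable def rainbowCopyCount {α C : Type} (G : SimpleGraph α) {n : ℕ}
    (c : Sym2 (Fin n) → C) : ℕ :=
  Set.ncard {S | IsRainbowCopy G c S}

/-- The Gallai-Ramsey multiplicity: the minimum, over exact `k`-colorings of the complete
graph on `gr_k(G:H)` vertices, of the number of rainbow copies of `G` plus the number of
monochromatic copies of `H`. -/
noncomputable def GM {α β : Type} (k : ℕ) (G : SimpleGraph α) (H : SimpleGraph β) : ℕ :=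
  sInf {t | ∃ c : Sym2 (Fin (gr k G H)) → Fin k, Surjective c ∧
    t = rainbowCopyCount G c + monoCopyCount H c}

end GR

namespace GR

open Finset in
/-- If every pair of distinct elements of `W` has equal labels under one of the labelings `ℓ i`,
then `#W` is bounded in terms of the sizes of the largest matchings inside the label classes. -/
lemma card_le_of_labelings_cover {V : Type*} [DecidableEq V] {k : ℕ} (W : Finset V)
    (m : Fin k → ℕ) (ℓ : ∀ i, V → Fin (m i))
    (cover : ∀ x ∈ W, ∀ y ∈ W, x ≠ y → ∃ i, ℓ i x = ℓ i y) (T : ℕ)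
    (hT : ∀ i, ∑ c, #{x ∈ W | ℓ i x = c} / 2 ≤ T) :
    #W ≤ ∑ i, ∑ c, #{x ∈ W | ℓ i x = c} / 2 + T + 1 := by
  by_cases hbig : ∃ i c, #W ≤ 2 * #{x ∈ W | ℓ i x = c}
  · obtain ⟨i, c, hc⟩ := hbig
    set C := {x ∈ W | ℓ i x = c} with hC
    set R := {x ∈ W | ¬ ℓ i x = c} with hR
    have hCR : #C + #R = #W := card_filter_add_card_filter_not _
    rcases Nat.eq_zero_or_pos #C with h0 | hpos
    · omega
    have hsub : R ×ˢ C ⊆ (univ.erase i).biUnion fun j => univ.biUnion fun e =>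
        {x ∈ R | ℓ j x = e} ×ˢ {x ∈ C | ℓ j x = e} := by
      rintro ⟨x, y⟩ hxy
      rw [mem_product, hC, hR, mem_filter, mem_filter] at hxy
      obtain ⟨⟨hx, hxc⟩, hy, hyc⟩ := hxy
      obtain ⟨j, hj⟩ := cover x hx y hy (by rintro rfl; exact hxc hyc)
      simp only [mem_biUnion, mem_product, mem_filter, mem_erase, mem_univ, hC, hR]
      exact ⟨j, ⟨by rintro rfl; exact hxc (hj.trans hyc), trivial⟩, ℓ j y, trivial,
        ⟨⟨hx, hxc⟩, hj⟩, ⟨hy, hyc⟩, rfl⟩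
    have hle : #R * #C ≤ (∑ j ∈ univ.erase i, ∑ e, #{x ∈ W | ℓ j x = e} / 2) * #C := by
      rw [← card_product, Finset.sum_mul]
      refine (card_le_card hsub).trans (card_biUnion_le.trans (sum_le_sum fun j _ => ?_))
      rw [Finset.sum_mul]
      refine card_biUnion_le.trans (sum_le_sum fun e _ => ?_)
      rw [card_product]
      have h1 : #{x ∈ C | ℓ j x = e} + #{x ∈ R | ℓ j x = e} = #{x ∈ W | ℓ j x = e} := by
        rw [← card_filter_add_card_filter_not (s := {x ∈ W | ℓ j x = e}) (fun x => ℓ i x = c),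
          hC, hR, filter_filter, filter_filter, filter_filter, filter_filter]
        simp only [and_comm]
      have h2 : #{x ∈ C | ℓ j x = e} ≤ #C := card_filter_le _ _
      have h3 : #{x ∈ R | ℓ j x = e} ≤ #R := card_filter_le _ _
      rw [← h1]
      rcases le_total #{x ∈ R | ℓ j x = e} #{x ∈ C | ℓ j x = e} with h | h
      · exact Nat.mul_le_mul (by omega) h2
      · rw [mul_comm]
        exact Nat.mul_le_mul (by omega) (by omega)
    have hRle := Nat.le_of_mul_le_mul_right hle hpos
    have hsplit := Finset.add_sum_erase univ (fun j => ∑ e, #{x ∈ W | ℓ j x = e} / 2)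
      (mem_univ i)
    have hCi : #C / 2 ≤ ∑ e, #{x ∈ W | ℓ i x = e} / 2 :=
      single_le_sum (f := fun e => #{x ∈ W | ℓ i x = e} / 2) (fun _ _ => Nat.zero_le _)
        (mem_univ c)
    have := hT i
    omega
  · push Not at hbig
    rcases Nat.eq_zero_or_pos #W with h0 | hpos
    · omega
    have hsub : W.offDiag ⊆ univ.biUnion fun j => univ.biUnion fun e =>
        {x ∈ W | ℓ j x = e}.offDiag := by
      rintro ⟨x, y⟩ hxy
      rw [mem_offDiag] at hxy
      obtain ⟨hx, hy, hne⟩ := hxy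
      obtain ⟨j, hj⟩ := cover x hx y hy hne
      simp only [mem_biUnion, mem_offDiag, mem_filter, mem_univ]
      exact ⟨j, trivial, ℓ j y, trivial, ⟨hx, hj⟩, ⟨hy, rfl⟩, hne⟩
    have hle : (#W - 1) * #W ≤ (∑ j, ∑ e, #{x ∈ W | ℓ j x = e} / 2) * #W := by
      rw [Nat.sub_mul, one_mul, ← offDiag_card, Finset.sum_mul]
      refine (card_le_card hsub).trans (card_biUnion_le.trans (sum_le_sum fun j _ => ?_))
      rw [Finset.sum_mul]
      refine card_biUnion_le.trans (sum_le_sum fun e _ => ?_)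
      have h1 := hbig j e
      rw [offDiag_card]
      generalize #{x ∈ W | ℓ j x = e} = a at *
      calc a * a - a = (a - 1) * a := by rw [Nat.sub_mul, one_mul]
        _ ≤ (2 * (a / 2)) * a := Nat.mul_le_mul_right _ (by omega)
        _ = (a / 2) * (2 * a) := by ring
        _ ≤ _ := Nat.mul_le_mul_left _ h1.le
    have := Nat.le_of_mul_le_mul_right hle hpos
    omega

/-- If an involution of a set `T` of at least `2 * n` vertices maps each vertex to a neighbor, then
the graph contains `n` disjoint edges. -/
lemma exists_matching_of_involution {N n : ℕ} (G : SimpleGraph (Fin N)) (T : Finset (Fin N))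
    (p : Fin N → Fin N) (hT : 2 * n ≤ T.card) (hadj : ∀ x ∈ T, G.Adj x (p x))
    (hp : ∀ x ∈ T, p x ∈ T) (hpp : ∀ x ∈ T, p (p x) = x) :
    ∃ f : Fin n × Fin 2 → Fin N, Injective f ∧ ∀ i, G.Adj (f (i, 0)) (f (i, 1)) := by
  classical
  set X := T.filter fun x => x < p x with hX
  have hcov : T ⊆ X ∪ X.image p := by
    intro x hx
    rcases lt_or_gt_of_ne (hadj x hx).ne with h | h
    · exact Finset.mem_union_left _ (Finset.mem_filter.2 ⟨hx, h⟩)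
    · refine Finset.mem_union_right _ (Finset.mem_image.2 ⟨p x, ?_, hpp x hx⟩)
      exact Finset.mem_filter.2 ⟨hp x hx, by rwa [hpp x hx]⟩
  have hXn : n ≤ X.card := by
    have h1 := Finset.card_le_card hcov
    have h2 := Finset.card_union_le X (X.image p)
    have h3 : (X.image p).card ≤ X.card := Finset.card_image_le
    omega
  obtain ⟨g⟩ : Nonempty (Fin n ↪ X) := by
    rw [Function.Embedding.nonempty_iff_card_le]
    simpa using hXn
  have hgT : ∀ i, (g i : Fin N) ∈ T := fun i => (Finset.mem_filter.1 (g i).2).1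
  have hgp : ∀ i, (g i : Fin N) < p (g i) := fun i => (Finset.mem_filter.1 (g i).2).2
  have hne : ∀ i j, (g i : Fin N) ≠ p (g j) := by
    intro i j h
    have h1 := hgp i
    have h2 := hgp j
    rw [h, hpp _ (hgT j)] at h1
    exact lt_asymm h1 h2
  have hginj : ∀ i j, (g i : Fin N) = g j → i = j := fun i j h => g.injective (Subtype.ext h)
  refine ⟨fun a => if a.2 = 0 then g a.1 else p (g a.1), ?_, fun i => by
    simpa using hadj _ (hgT i)⟩
  rintro ⟨i, a⟩ ⟨j, b⟩ h
  fin_cases a <;> fin_cases b <;> simp at h ⊢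
  · exact h
  · exact hne i j h
  · exact hne j i h.symm
  · exact hginj i j (by rw [← hpp _ (hgT i), h, hpp _ (hgT j)])

/-- The join of `G` with a complete graph on `d` vertices. -/
def joinComplete {V : Type*} (G : SimpleGraph V) (d : ℕ) : SimpleGraph (V ⊕ Fin d) where
  Adj x y := x ≠ y ∧ ∀ a b, x = Sum.inl a → y = Sum.inl b → G.Adj a b
  symm := ⟨fun _ _ h => ⟨h.1.symm, fun a b ha hb => (h.2 b a hb ha).symm⟩⟩
  loopless := ⟨fun _ h => h.1 rfl⟩

/-- A perfect matching of the join of `G` with a complete graph on `d` vertices contains at least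
`n` edges of `G` when `G` has `2 * n + d` vertices. -/
lemma exists_matching_of_isPerfectMatching {N n d : ℕ} (G : SimpleGraph (Fin N))
    (hd : N = 2 * n + d) (M : (joinComplete G d).Subgraph) (hM : M.IsPerfectMatching) :
    ∃ f : Fin n × Fin 2 → Fin N, Injective f ∧ ∀ i, G.Adj (f (i, 0)) (f (i, 1)) := by
  classical
  rw [Subgraph.isPerfectMatching_iff] at hM
  choose r hr hru using hM
  have hrr : ∀ v, r (r v) = v := fun v => (hru (r v) v (hr v).symm).symm
  refine exists_matching_of_involution G
    (Finset.univ.filter fun x : Fin N => ∃ y : Fin N, r (Sum.inl x) = Sum.inl y)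
    (fun x => Sum.elim id (fun _ => x) (r (Sum.inl x))) ?_ ?_ ?_ ?_
  · have hc := Finset.card_filter_add_card_filter_not (s := (Finset.univ : Finset (Fin N)))
      (fun x : Fin N => ∃ y : Fin N, r (Sum.inl x) = Sum.inl y)
    have hle : (Finset.univ.filter fun x : Fin N =>
        ¬ ∃ y : Fin N, r (Sum.inl x) = Sum.inl y).card ≤ d := by
      have : (Finset.univ.filter fun x : Fin N =>
          ¬ ∃ y : Fin N, r (Sum.inl x) = Sum.inl y).image (fun x => r (Sum.inl x)) ⊆
          (Finset.univ : Finset (Fin d)).image Sum.inr := by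
        intro z hz
        obtain ⟨x, hx, rfl⟩ := Finset.mem_image.1 hz
        have hx := (Finset.mem_filter.1 hx).2
        rcases h : r (Sum.inl x) with y | y
        · exact absurd ⟨y, h⟩ hx
        · simp
      have h2 := (Finset.card_le_card this).trans Finset.card_image_le
      rw [Finset.card_image_of_injective _ (fun x y h => Sum.inl_injective
        (by rw [← hrr (Sum.inl x), h, hrr]))] at h2
      simpa using h2
    rw [Finset.card_univ, Fintype.card_fin] at hc
    omega
  all_goals
    intro x hx
    obtain ⟨y, hy⟩ := (Finset.mem_filter.1 hx).2
    have hyx : r (Sum.inl y) = Sum.inl x := by rw [← hy, hrr]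
  · simp only [hy, Sum.elim_inl, id]
    have := (hr (Sum.inl x)).adj_sub
    rw [hy] at this
    exact this.2 x y rfl rfl
  · simp [hy, hyx]
  · simp [hy, hyx]

open Finset in
/-- One direction of the Tutte–Berge formula: if `G` has no `n` disjoint edges, then this is
certified by a set `S` and a labeling which is constant on the components of `G - S`. -/
lemma exists_barrier_of_no_matching {N n : ℕ} (G : SimpleGraph (Fin N)) (hN : 2 * n ≤ N)
    (h : ¬ ∃ f : Fin n × Fin 2 → Fin N, Injective f ∧ ∀ i, G.Adj (f (i, 0)) (f (i, 1))) :
    ∃ (S : Finset (Fin N)) (m : ℕ) (ℓ : Fin N → Fin m),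
      (∀ x y, x ∉ S → y ∉ S → G.Adj x y → ℓ x = ℓ y) ∧
      #S + ∑ c, #{x ∈ Sᶜ | ℓ x = c} / 2 < n := by
  classical
  obtain ⟨d, hd⟩ := Nat.exists_eq_add_of_le hN
  have hno : ¬ ∃ M : (joinComplete G d).Subgraph, M.IsPerfectMatching :=
    fun ⟨M, hM⟩ => h (exists_matching_of_isPerfectMatching G hd M hM)
  rw [tutte] at hno
  push Not at hno
  obtain ⟨u, hu⟩ := hno
  unfold IsTutteViolator at hu
  set D := ((⊤ : (joinComplete G d).Subgraph).deleteVerts u).coe with hD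
  have hmem : ∀ v, v ∉ u → v ∈ ((⊤ : (joinComplete G d).Subgraph).deleteVerts u).verts := by
    intro v hv; simp [hv]
  have hmem' : ∀ v : ((⊤ : (joinComplete G d).Subgraph).deleteVerts u).verts, v.1 ∉ u := by
    rintro ⟨v, hv⟩; simpa using hv
  have hDadj : ∀ a b (ha : a ∉ u) (hb : b ∉ u), (joinComplete G d).Adj a b →
      D.Adj ⟨a, hmem a ha⟩ ⟨b, hmem b hb⟩ := by
    intro a b ha hb hab
    simp [hD, ha, hb, hab]
  have hcardD : Nat.card ((⊤ : (joinComplete G d).Subgraph).deleteVerts u).verts + u.ncard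
      = N + d := by
    have : ((⊤ : (joinComplete G d).Subgraph).deleteVerts u).verts = uᶜ := by
      ext; simp
    rw [this, Nat.card_coe_set_eq, add_comm, Set.ncard_add_ncard_compl]
    simp
  have hpar := odd_ncard_oddComponents D
  have hu2 : u.ncard + 2 ≤ D.oddComponents.ncard := by
    by_contra hlt
    have h1 : D.oddComponents.ncard = u.ncard + 1 := by omega
    rw [h1, Nat.odd_iff, Nat.odd_iff] at hpar
    omega
  have hur : ∀ w : Fin d, Sum.inr w ∈ u := by
    intro w
    by_contra hw
    have hsub : Subsingleton D.ConnectedComponent := by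
      have key : ∀ c : D.ConnectedComponent,
          c = D.connectedComponentMk ⟨Sum.inr w, hmem _ hw⟩ := by
        intro c
        induction c using ConnectedComponent.ind with | _ v
        by_cases hv : v = ⟨Sum.inr w, hmem _ hw⟩
        · rw [hv]
        · refine ConnectedComponent.sound (Adj.reachable ?_)
          refine hDadj _ _ (hmem' v) hw ⟨fun h => hv (Subtype.ext h), ?_⟩
          simp
      exact ⟨fun a b => (key a).trans (key b).symm⟩
    have := Set.ncard_le_one_of_subsingleton D.oddComponents
    omega
  set S : Finset (Fin N) := {x | Sum.inl x ∈ u} with hS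
  have hSu : u.ncard = #S + d := by
    have : u = ((S.image Sum.inl ∪ univ.image Sum.inr : Finset (Fin N ⊕ Fin d)) :
        Set (Fin N ⊕ Fin d)) := by
      ext (x | x) <;> simp [hS, hur]
    rw [this, Set.ncard_coe_finset, card_union_of_disjoint, card_image_of_injective _
      Sum.inl_injective, card_image_of_injective _ Sum.inr_injective, card_univ, Fintype.card_fin]
    rw [Finset.disjoint_left]
    simp
  let lab : Fin N → Option D.ConnectedComponent := fun x =>
    if hx : Sum.inl x ∈ u then none else some (D.connectedComponentMk ⟨Sum.inl x, hmem _ hx⟩)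
  let e := Fintype.equivFin (Option D.ConnectedComponent)
  refine ⟨S, _, fun x => e (lab x), ?_, ?_⟩
  · intro x y hx hy hxy
    have hx' : Sum.inl x ∉ u := by simpa [hS] using hx
    have hy' : Sum.inl y ∉ u := by simpa [hS] using hy
    simp only [lab, hx', hy', dite_false, EmbeddingLike.apply_eq_iff_eq, Option.some.injEq]
    refine ConnectedComponent.sound (Adj.reachable (hDadj _ _ hx' hy' ⟨?_, ?_⟩))
    · simpa using hxy.ne
    · rintro a b ha hb
      rw [← Sum.inl_injective ha, ← Sum.inl_injective hb]
      exact hxy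
  · have hsum : ∑ c, #{x ∈ Sᶜ | e (lab x) = c} / 2 =
        ∑ c, #{x ∈ Sᶜ | lab x = c} / 2 := by
      rw [← e.sum_comp]
      simp
    have htot : #Sᶜ = ∑ c, #{x ∈ Sᶜ | lab x = c} :=
      card_eq_sum_card_fiberwise fun _ _ => mem_coe.2 (mem_univ _)
    have hodd : D.oddComponents.ncard ≤ ∑ c, #{x ∈ Sᶜ | lab x = c} % 2 := by
      have hcomp : ∀ c : D.ConnectedComponent,
          #{x ∈ Sᶜ | lab x = some c} = c.supp.ncard := by
        intro c
        rw [← Set.ncard_image_of_injective c.supp Subtype.val_injective,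
          ← card_image_of_injective _ (Sum.inl_injective (β := Fin d)), ← Set.ncard_coe_finset]
        congr 1
        ext (x | x)
        · by_cases hx : Sum.inl x ∈ u
          · simp [lab, hx, hS]
          · simp [lab, hx, hS]
        · simp [hur]
      rw [Set.ncard_eq_toFinset_card', Fintype.sum_option, card_eq_sum_ones]
      refine le_trans ?_ (Nat.le_add_left _ _)
      refine le_trans (sum_le_sum fun c hc => ?_)
        (sum_le_sum_of_subset (subset_univ (D.oddComponents.toFinset)))
      rw [hcomp c]
      have : Odd c.supp.ncard := by simpa using hc
      exact (Nat.odd_iff.1 this).ge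
    have hdiv : ∑ c, #{x ∈ Sᶜ | lab x = c} =
        2 * ∑ c, #{x ∈ Sᶜ | lab x = c} / 2 + ∑ c, #{x ∈ Sᶜ | lab x = c} % 2 := by
      rw [mul_sum, ← sum_add_distrib]
      exact sum_congr rfl fun c _ => (Nat.div_add_mod _ 2).symm
    have hSc : #S + #Sᶜ = N := by simp [card_add_card_compl]
    rw [hsum]
    omega

lemma nK2_adj {n : ℕ} {a b : Fin n × Fin 2} : (nK2 n).Adj a b ↔ a ≠ b ∧ a.1 = b.1 := by
  simp [nK2, eq_comm]

lemma map_image_nK2_edgeSet {n : ℕ} {V : Type*} (f : Fin n × Fin 2 → V) :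
    Sym2.map f '' (nK2 n).edgeSet = Set.range fun i => s(f (i, 0), f (i, 1)) := by
  ext e
  constructor
  · rintro ⟨z, hz, rfl⟩
    induction z using Sym2.ind with | _ x y
    obtain ⟨i, a⟩ := x
    obtain ⟨j, b⟩ := y
    rw [mem_edgeSet, nK2_adj] at hz
    obtain ⟨hne, hij⟩ := hz
    simp only at hij
    subst hij
    refine ⟨i, ?_⟩
    fin_cases a <;> fin_cases b <;> simp at hne ⊢
  · rintro ⟨i, rfl⟩
    exact ⟨s((i, 0), (i, 1)), by simp [nK2_adj], rfl⟩

lemma isMonoCopy_nK2_iff {C : Type} {N n : ℕ} {c : Sym2 (Fin N) → C} {S : Set (Sym2 (Fin N))} :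
    IsMonoCopy (nK2 n) c S ↔ ∃ f : Fin n × Fin 2 → Fin N, Injective f ∧
      (S = Set.range fun i => s(f (i, 0), f (i, 1))) ∧
      ∃ col, ∀ i, c s(f (i, 0), f (i, 1)) = col := by
  constructor
  · rintro ⟨⟨f, hf, rfl⟩, col, hcol⟩
    rw [map_image_nK2_edgeSet] at hcol ⊢
    exact ⟨f, hf, rfl, col, fun i => hcol _ ⟨i, rfl⟩⟩
  · rintro ⟨f, hf, rfl, col, hcol⟩
    refine ⟨⟨f, hf, (map_image_nK2_edgeSet f).symm⟩, col, ?_⟩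
    rintro _ ⟨i, rfl⟩
    exact hcol i

open Finset in
/-- The upper bound in the Cockayne–Lorimer theorem, for matchings of equal size. -/
theorem hasMonoCopy_nK2 {k n N : ℕ} (hk : 0 < k) (hn : 0 < n)
    (hN : (k + 1) * (n - 1) + 2 ≤ N) (c : Sym2 (Fin N) → Fin k) : HasMonoCopy (nK2 n) c := by
  classical
  by_contra hno
  let G : Fin k → SimpleGraph (Fin N) := fun j =>
    { Adj := fun x y => x ≠ y ∧ c s(x, y) = j
      symm := ⟨fun x y h => ⟨h.1.symm, by rw [Sym2.eq_swap]; exact h.2⟩⟩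
      loopless := ⟨fun _ h => h.1 rfl⟩ }
  have h2n : 2 * n ≤ N := by
    have : 2 * (n - 1) ≤ (k + 1) * (n - 1) := Nat.mul_le_mul_right _ (by omega)
    omega
  have hG : ∀ j, ∃ (S : Finset (Fin N)) (m : ℕ) (ℓ : Fin N → Fin m),
      (∀ x y, x ∉ S → y ∉ S → (G j).Adj x y → ℓ x = ℓ y) ∧
      #S + ∑ c, #{x ∈ Sᶜ | ℓ x = c} / 2 < n := fun j =>
    exists_barrier_of_no_matching (G j) h2n fun ⟨f, hf, hadj⟩ =>
      hno ⟨_, isMonoCopy_nK2_iff.2 ⟨f, hf, rfl, j, fun i => (hadj i).2⟩⟩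
  choose S m ℓ hℓ hlt using hG
  set W : Finset (Fin N) := (univ.biUnion S)ᶜ with hW
  have hWS : ∀ j, W ⊆ (S j)ᶜ := fun j =>
    compl_subset_compl.2 (subset_biUnion_of_mem S (mem_univ j))
  have ht : ∀ j, ∑ e, #{x ∈ W | ℓ j x = e} / 2 ≤ ∑ e, #{x ∈ (S j)ᶜ | ℓ j x = e} / 2 :=
    fun j => sum_le_sum fun e _ =>
      Nat.div_le_div_right (card_le_card (filter_subset_filter _ (hWS j)))
  have hWcard := card_le_of_labelings_cover W m ℓ
    (fun x hx y hy hne => ⟨c s(x, y), hℓ _ x y (mem_compl.1 (hWS _ hx)) (mem_compl.1 (hWS _ hy))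
      ⟨hne, rfl⟩⟩) (n - 1) (fun j => by have := ht j; have := hlt j; omega)
  have hScard : #(univ.biUnion S) ≤ ∑ j, #(S j) := card_biUnion_le
  have hsum : ∑ j, #(S j) + ∑ j, ∑ e, #{x ∈ W | ℓ j x = e} / 2 ≤ k * (n - 1) := by
    rw [← sum_add_distrib]
    refine (sum_le_sum (g := fun _ => n - 1) fun j _ => ?_).trans (by simp)
    have := ht j
    have := hlt j
    omega
  have hNW : #(univ.biUnion S) + #W = N := by
    rw [hW, card_add_card_compl, Fintype.card_fin]
  rw [add_mul] at hN
  omega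

/-- The level of `v` when the first `m` vertices have level `0` and the subsequent blocks of `q`
vertices have levels `1`, `2`, .... -/
def level (m q v : ℕ) : ℕ := if v < m then 0 else 1 + (v - m) / q

lemma level_lt {m q v k : ℕ} (hk : 0 < k) (hv : v < m + (k - 1) * q) : level m q v < k := by
  unfold level
  split_ifs with h
  · exact hk
  · have : (v - m) / q < k - 1 := by
      refine Nat.div_lt_of_lt_mul ?_
      rw [mul_comm]
      omega
    omega

lemma level_eq_zero {m q v : ℕ} : level m q v = 0 ↔ v < m := by
  unfold level
  split_ifs with h <;> simp [h]

lemma level_add {m q j : ℕ} (hq : 0 < q) : level m q (m + j * q) = j + 1 := by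
  simp [level, hq, add_comm]

lemma card_level_fiber_le {N m q j : ℕ} (hq : 0 < q) (hj : j ≠ 0) :
    (Finset.univ.filter fun v : Fin N => level m q v = j).card ≤ q := by
  obtain ⟨i, rfl⟩ := Nat.exists_eq_succ_of_ne_zero hj
  rw [← Finset.card_image_of_injective _ Fin.val_injective]
  calc _ ≤ (Finset.Ico (m + i * q) (m + i * q + q)).card := Finset.card_le_card ?_
    _ = q := by simp
  intro v hv
  obtain ⟨w, hw, rfl⟩ := Finset.mem_image.1 hv
  have hw := (Finset.mem_filter.1 hw).2
  unfold level at hw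
  split_ifs at hw with h
  have h2 : ((w : ℕ) - m) / q = i := by omega
  rw [Nat.div_eq_iff hq] at h2
  rw [Finset.mem_Ico]
  omega

/-- `c` colors each edge by the level of its larger endpoint. -/
def IsLevelColoring {N k : ℕ} (m q : ℕ) (c : Sym2 (Fin N) → Fin k) : Prop :=
  ∀ x y, (c s(x, y) : ℕ) = level m q (max x y : Fin N)

lemma exists_isLevelColoring {N k m q : ℕ} (hk : 0 < k) (hN : N ≤ m + (k - 1) * q) :
    ∃ c : Sym2 (Fin N) → Fin k, IsLevelColoring m q c :=
  ⟨Sym2.lift ⟨fun x y => ⟨level m q (max x y : Fin N), level_lt hk (by omega)⟩,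
    fun x y => by simp only [max_comm]⟩, fun _ _ => rfl⟩

lemma IsLevelColoring.surjective {N k m q : ℕ} {c : Sym2 (Fin N) → Fin k}
    (hc : IsLevelColoring m q c) (hm : 0 < m) (hq : 0 < q) (hN : m + (k - 1) * q ≤ N) :
    Surjective c := by
  rintro ⟨j, hj⟩
  rcases j with _ | j
  · refine ⟨s(⟨0, by omega⟩, ⟨0, by omega⟩), Fin.ext ?_⟩
    rw [hc, level_eq_zero.2 (by simpa using hm)]
  · have hlt : m + j * q < N := by
      have : (j + 1) * q ≤ (k - 1) * q := Nat.mul_le_mul_right _ (by omega)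
      rw [add_mul] at this
      omega
    refine ⟨s(⟨m + j * q, hlt⟩, ⟨m + j * q, hlt⟩), Fin.ext ?_⟩
    rw [hc]
    simp [level_add hq]

lemma IsLevelColoring.not_isRainbowCopy {N k m q : ℕ} {c : Sym2 (Fin N) → Fin k}
    (hc : IsLevelColoring m q c) (S : Set (Sym2 (Fin N))) : ¬ IsRainbowCopy K3 c S := by
  rintro ⟨⟨f, hf, rfl⟩, hinj⟩
  have key : ∀ a b d : Fin 3, a ≠ b → a ≠ d → b ≠ d → f a < f d → f b < f d → False := by
    intro a b d hab had hbd h1 h2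
    have had' : s(f a, f d) ∈ Sym2.map f '' K3.edgeSet :=
      ⟨s(a, d), by simpa [K3] using had, rfl⟩
    have hbd' : s(f b, f d) ∈ Sym2.map f '' K3.edgeSet :=
      ⟨s(b, d), by simpa [K3] using hbd, rfl⟩
    have h := hinj had' hbd'
      (Fin.ext (by rw [hc, hc, max_eq_right h1.le, max_eq_right h2.le]))
    rw [Sym2.congr_left] at h
    exact hab (hf h)
  have h01 : f 0 ≠ f 1 := hf.ne (by decide)
  have h02 : f 0 ≠ f 2 := hf.ne (by decide)
  have h12 : f 1 ≠ f 2 := hf.ne (by decide)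
  have k0 := key 1 2 0 (by decide) (by decide) (by decide)
  have k1 := key 0 2 1 (by decide) (by decide) (by decide)
  have k2 := key 0 1 2 (by decide) (by decide) (by decide)
  rcases lt_or_gt_of_ne h01 with h | h <;> rcases lt_or_gt_of_ne h02 with h' | h' <;>
    rcases lt_or_gt_of_ne h12 with h'' | h'' <;>
    first
    | exact k0 ‹_› ‹_›
    | exact k1 ‹_› ‹_›
    | exact k2 ‹_› ‹_›
    | omega

/-- All edges of a monochromatic `n`-matching of a level coloring with blocks of size `n - 1`
have level `0`. -/
lemma IsLevelColoring.lt_of_mono {N k m n : ℕ} {c : Sym2 (Fin N) → Fin k} (hn : 2 ≤ n)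
    (hc : IsLevelColoring m (n - 1) c) {f : Fin n × Fin 2 → Fin N} (hf : Injective f)
    {col : Fin k} (hcol : ∀ i, c s(f (i, 0), f (i, 1)) = col) (a : Fin n × Fin 2) :
    (f a : ℕ) < m := by
  have hlev : ∀ i, level m (n - 1) (max (f (i, 0)) (f (i, 1)) : Fin N) = col := fun i => by
    rw [← hc, hcol]
  have h0 : (col : ℕ) = 0 := by
    by_contra h0
    have hle := card_level_fiber_le (N := N) (m := m) (q := n - 1) (by omega) h0
    have hinj : Injective fun i : Fin n => max (f (i, 0)) (f (i, 1)) := by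
      intro i j hij
      simp only at hij
      rcases max_choice (f (i, 0)) (f (i, 1)) with h1 | h1 <;>
      rcases max_choice (f (j, 0)) (f (j, 1)) with h2 | h2 <;>
      · rw [h1, h2] at hij
        exact congrArg Prod.fst (hf hij)
    have hge : n ≤ (Finset.univ.filter fun v : Fin N => level m (n - 1) v = col).card := by
      calc n = (Finset.univ.image fun i : Fin n => max (f (i, 0)) (f (i, 1))).card := by
            rw [Finset.card_image_of_injective _ hinj, Finset.card_univ, Fintype.card_fin]
        _ ≤ _ := Finset.card_le_card fun v hv => by
            obtain ⟨i, -, rfl⟩ := Finset.mem_image.1 hv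
            exact Finset.mem_filter.2 ⟨Finset.mem_univ _, hlev i⟩
    omega
  obtain ⟨i, b⟩ := a
  have hlt := level_eq_zero.1 ((hlev i).trans h0)
  have h1 : f (i, 0) ≤ max (f (i, 0)) (f (i, 1)) := le_max_left _ _
  have h2 : f (i, 1) ≤ max (f (i, 0)) (f (i, 1)) := le_max_right _ _
  rw [Fin.le_def] at h1 h2
  fin_cases b
  · exact h1.trans_lt hlt
  · exact h2.trans_lt hlt

theorem gr_K3_nK2 {k n : ℕ} (hk : 0 < k) (hn : 2 ≤ n) :
    gr k K3 (nK2 n) = (k + 1) * (n - 1) + 2 := by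
  have hmem : (k + 1) * (n - 1) + 2 ∈
      {N | ∀ c : Sym2 (Fin N) → Fin k, HasRainbowCopy K3 c ∨ HasMonoCopy (nK2 n) c} :=
    fun c => Or.inr (hasMonoCopy_nK2 hk (by omega) le_rfl c)
  refine le_antisymm (Nat.sInf_le hmem) (le_csInf ⟨_, hmem⟩ fun N hN => ?_)
  by_contra! hlt
  obtain ⟨k, rfl⟩ := Nat.exists_eq_succ_of_ne_zero hk.ne'
  obtain ⟨c, hc⟩ := exists_isLevelColoring (N := N) (m := 2 * n - 1) (q := n - 1) hk (by
    simp only [Nat.succ_eq_add_one, Nat.add_sub_cancel, add_mul] at hlt ⊢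
    omega)
  rcases hN c with ⟨S, hS⟩ | ⟨S, hS⟩
  · exact hc.not_isRainbowCopy S hS
  · obtain ⟨f, hf, -, col, hcol⟩ := isMonoCopy_nK2_iff.1 hS
    have hlt := hc.lt_of_mono hn hf hcol
    have := Fintype.card_le_of_injective (fun a => (⟨f a, hlt a⟩ : Fin (2 * n - 1)))
      fun a b h => hf (Fin.ext (by simpa using h))
    simp at this
    omega

/-- `S` is the edge set of a perfect matching of the complete graph on `A`. -/
def IsPerfectMatchingOn {V : Type*} (A : Finset V) (S : Set (Sym2 V)) : Prop :=
  (∀ e ∈ S, ¬ e.IsDiag ∧ ∀ v ∈ e, v ∈ A) ∧ ∀ v ∈ A, ∃! e, e ∈ S ∧ v ∈ e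

open Nat in
lemma ncard_isPerfectMatchingOn_le {V : Type*} [Finite V] [DecidableEq V] (n : ℕ) (A : Finset V)
    (hA : A.card = 2 * n) : {S | IsPerfectMatchingOn A S}.ncard ≤ (2 * n - 1)‼ := by
  induction n generalizing A with
  | zero =>
    refine (Set.ncard_le_one_iff_subsingleton).2 fun S hS T hT => ?_
    obtain rfl : A = ∅ := by simpa using hA
    have key : ∀ S, IsPerfectMatchingOn (∅ : Finset V) S → S = ∅ := by
      intro S hS
      refine Set.eq_empty_of_forall_notMem fun e he => ?_
      induction e using Sym2.ind with | _ x y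
      simpa using (hS.1 _ he).2 x (by simp)
    rw [key S hS, key T hT]
  | succ n ih =>
    obtain ⟨a, ha⟩ : A.Nonempty := Finset.card_pos.1 (by omega)
    have hsub : {S | IsPerfectMatchingOn A S} ⊆ ⋃ b ∈ A.erase a,
        insert s(a, b) '' {S | IsPerfectMatchingOn ((A.erase a).erase b) S} := by
      intro S hS
      obtain ⟨e, ⟨heS, hae⟩, heu⟩ := hS.2 a ha
      obtain ⟨b, rfl⟩ := hae
      have hab : a ≠ b := by simpa using (hS.1 _ heS).1
      have hb : b ∈ A := (hS.1 _ heS).2 b (by simp)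
      have huniq : ∀ e ∈ S, a ∈ e ∨ b ∈ e → e = s(a, b) := by
        rintro e he (h | h)
        · exact (hS.2 a ha).unique ⟨he, h⟩ ⟨heS, by simp⟩
        · exact (hS.2 b hb).unique ⟨he, h⟩ ⟨heS, by simp⟩
      refine Set.mem_iUnion₂.2 ⟨b, Finset.mem_erase.2 ⟨hab.symm, hb⟩, S \ {s(a, b)}, ⟨?_, ?_⟩, ?_⟩
      · rintro e ⟨he, hne⟩
        refine ⟨(hS.1 e he).1, fun v hv => Finset.mem_erase.2 ⟨?_, Finset.mem_erase.2
          ⟨?_, (hS.1 e he).2 v hv⟩⟩⟩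
        · rintro rfl
          exact hne (huniq e he (Or.inr hv))
        · rintro rfl
          exact hne (huniq e he (Or.inl hv))
      · intro v hv
        simp only [Finset.mem_erase] at hv
        obtain ⟨e, ⟨he, hve⟩, hu⟩ := hS.2 v hv.2.2
        refine ⟨e, ⟨⟨he, ?_⟩, hve⟩, fun e' h' => hu e' ⟨h'.1.1, h'.2⟩⟩
        rintro rfl
        rcases Sym2.mem_iff.1 hve with h | h
        · exact hv.2.1 h
        · exact hv.1 h
      · exact Set.insert_sdiff_self_of_mem heS
    calc _ ≤ _ := Set.ncard_le_ncard hsub (Set.toFinite _)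
      _ ≤ ∑ b ∈ A.erase a, _ := Finset.set_ncard_biUnion_le _ _
      _ ≤ ∑ b ∈ A.erase a, (2 * n - 1)‼ := Finset.sum_le_sum fun b hb =>
          (Set.ncard_image_le (Set.toFinite _)).trans (ih _ (by
            rw [Finset.card_erase_of_mem hb, Finset.card_erase_of_mem ha]
            omega))
      _ = (2 * (n + 1) - 1)‼ := by
          rw [Finset.sum_const, Finset.card_erase_of_mem ha, hA, smul_eq_mul,
            show 2 * (n + 1) - 1 = 2 * n + 1 by omega, doubleFactorial_add_one]

open Nat in
lemma IsLevelColoring.monoCopyCount_le {N k n : ℕ} {c : Sym2 (Fin N) → Fin k} (hn : 2 ≤ n)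
    (hN : 2 * n ≤ N) (hc : IsLevelColoring (2 * n) (n - 1) c) :
    monoCopyCount (nK2 n) c ≤ (2 * n - 1)‼ := by
  set A : Finset (Fin N) := Finset.univ.image (Fin.castLE hN) with hA
  have hAcard : A.card = 2 * n := by
    rw [hA, Finset.card_image_of_injective _ (Fin.castLE_injective hN), Finset.card_univ,
      Fintype.card_fin]
  refine (Set.ncard_le_ncard (fun S hS => ?_) (Set.toFinite _)).trans
    (ncard_isPerfectMatchingOn_le n A hAcard)
  obtain ⟨f, hf, rfl, col, hcol⟩ := isMonoCopy_nK2_iff.1 hS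
  have hlt := hc.lt_of_mono hn hf hcol
  have hfA : ∀ a, f a ∈ A := fun a =>
    Finset.mem_image.2 ⟨⟨f a, hlt a⟩, Finset.mem_univ _, rfl⟩
  have himage : Finset.univ.image f = A := by
    refine Finset.eq_of_subset_of_card_le (fun v hv => ?_) ?_
    · obtain ⟨a, -, rfl⟩ := Finset.mem_image.1 hv
      exact hfA a
    · rw [hAcard, Finset.card_image_of_injective _ hf, Finset.card_univ]
      simp [mul_comm]
  refine ⟨?_, fun v hv => ?_⟩
  · rintro _ ⟨i, rfl⟩
    refine ⟨by simp [hf.eq_iff], fun v hv => ?_⟩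
    rcases Sym2.mem_iff.1 hv with rfl | rfl <;> exact hfA _
  · rw [← himage] at hv
    obtain ⟨⟨i, b⟩, -, rfl⟩ := Finset.mem_image.1 hv
    refine ⟨s(f (i, 0), f (i, 1)), ⟨⟨i, rfl⟩, ?_⟩, ?_⟩
    · fin_cases b <;> simp
    · rintro _ ⟨⟨j, rfl⟩, hj⟩
      have : i = j := by
        rcases Sym2.mem_iff.1 hj with h | h <;> exact congrArg Prod.fst (hf h)
      rw [this]

end GR

open GR Nat in
/-- For `k ≥ 6` and `n ≥ 2`, `GM_k(K₃ : nK₂) ≤ (2n − 1)!!`. -/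
theorem GM_triangle_matching_le (k n : ℕ) (hk : 6 ≤ k) (hn : 2 ≤ n) :
    GM k K3 (nK2 n) ≤ (2 * n - 1)‼ := by
  have hgr : gr k K3 (nK2 n) = 2 * n + (k - 1) * (n - 1) := by
    rw [gr_K3_nK2 (by omega) hn]
    obtain ⟨j, rfl⟩ := Nat.exists_eq_add_of_le' hk
    rw [show j + 6 - 1 = j + 5 by omega, add_mul, add_mul, add_mul]
    omega
  obtain ⟨c, hc⟩ := exists_isLevelColoring (by omega) hgr.le
  have hle : GM k K3 (nK2 n) ≤ rainbowCopyCount K3 c + monoCopyCount (nK2 n) c :=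
    Nat.sInf_le ⟨c, hc.surjective (by omega) (by omega) hgr.ge, rfl⟩
  refine hle.trans ?_
  have hrainbow : rainbowCopyCount K3 c = 0 := by
    unfold rainbowCopyCount
    rw [Set.eq_empty_of_forall_notMem (s := {S | IsRainbowCopy K3 c S}) hc.not_isRainbowCopy,
      Set.ncard_empty]
  rw [hrainbow, zero_add]
  exact hc.monoCopyCount_le hn (by omega)
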